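/- There exist absolute constants 0 < τ < 10⁻⁴ and c ≥ τ, and n₀ ∈ ℕ, such that for all n ≥ n₀ the following holds. Let K ⊆ ℝⁿ be a convex set (viewed as a ±1-valued function) with |vol(K) − 1/2| ≤ c/n, and suppose there exists a point x ∉ K with ‖x‖₂ ≤ τ. Then the Hermite weight of K at levels 0 and 1 satisfies W^{≤1}[K] = W^{=0}[K] + W^{=1}[K] ≥ 1/18. -/

import Mathlib

open MeasureTheory ProbabilityTheory

/-- The standard Gaussian measure `N(0,1)ⁿ` on `ℝⁿ`. -/
noncomputable def stdGaussian (n : ℕ) : Measure (EuclideanSpace ℝ (Fin n)) :=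
  (Measure.pi fun _ : Fin n => gaussianReal 0 1).map
    (EuclideanSpace.equiv (Fin n) ℝ).symm

open Classical in
/-- The `±1`-valued function associated to a set `K`. -/
noncomputable def pmInd {n : ℕ} (K : Set (EuclideanSpace ℝ (Fin n)))
    (x : EuclideanSpace ℝ (Fin n)) : ℝ :=
  if x ∈ K then 1 else -1

/-- The normalized probabilists' Hermite polynomial `h_d(x) = He_d(x)/√(d!)`,
orthonormal with respect to `N(0,1)`. -/
noncomputable def normHermite (d : ℕ) (x : ℝ) : ℝ :=
  (Polynomial.aeval x (Polynomial.hermite d)) / Real.sqrt (Nat.factorial d)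

/-- The Hermite coefficient `f̃(S) = E_{g ∼ N(0,1)ⁿ}[f(g) · ∏ᵢ h_{Sᵢ}(gᵢ)]`. -/
noncomputable def hermiteCoeff (n : ℕ) (f : EuclideanSpace ℝ (Fin n) → ℝ)
    (S : Fin n → ℕ) : ℝ :=
  ∫ x, f x * ∏ i, normHermite (S i) (x i) ∂(stdGaussian n)

/-- The Hermite weight of `f` at level `j`: `W^{=j}[f] = Σ_{|S| = j} f̃(S)²`. -/
noncomputable def hermiteWeight (n : ℕ) (f : EuclideanSpace ℝ (Fin n) → ℝ)
    (j : ℕ) : ℝ :=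
  ∑' S : {S : Fin n → ℕ // ∑ i, S i = j}, (hermiteCoeff n f S.1) ^ 2

/-- The Gaussian volume of `K ⊆ ℝⁿ`. -/
noncomputable def gaussVol (n : ℕ) (K : Set (EuclideanSpace ℝ (Fin n))) : ℝ :=
  (stdGaussian n K).toReal

theorem pi_gaussianReal_absolutelyContinuous (n : ℕ) :
    (Measure.pi fun _ : Fin n => gaussianReal 0 1) ≪ Measure.pi fun _ : Fin n => volume := by
  induction n with
  | zero =>
    rw [Measure.pi_of_empty, Measure.pi_of_empty]
  | succ n ih =>
    have hg := measurePreserving_piFinSuccAbove (fun _ : Fin (n + 1) => gaussianReal 0 1) 0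
    have hv := measurePreserving_piFinSuccAbove (fun _ : Fin (n + 1) => (volume : Measure ℝ)) 0
    rw [← hg.symm.map_eq, ← hv.symm.map_eq]
    exact ((gaussianReal_absolutelyContinuous 0 one_ne_zero).prod ih).map
      (MeasurableEquiv.measurable _)

theorem stdGaussian_eq (n : ℕ) :
    _root_.stdGaussian n = ProbabilityTheory.stdGaussian (EuclideanSpace ℝ (Fin n)) :=
  map_pi_eq_stdGaussian

theorem stdGaussian_absolutelyContinuous (n : ℕ) :
    ProbabilityTheory.stdGaussian (EuclideanSpace ℝ (Fin n)) ≪ volume := by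
  rw [← map_pi_eq_stdGaussian, ← (PiLp.volume_preserving_toLp (Fin n)).map_eq]
  exact (pi_gaussianReal_absolutelyContinuous n).map (by fun_prop)

theorem interior_ae_eq_of_convex {n : ℕ} {K : Set (EuclideanSpace ℝ (Fin n))}
    (hK : Convex ℝ K) :
    interior K =ᵐ[ProbabilityTheory.stdGaussian (EuclideanSpace ℝ (Fin n))] K :=
  interior_ae_eq_of_null_frontier (stdGaussian_absolutelyContinuous n (hK.addHaar_frontier _))

theorem map_inner_stdGaussian {n : ℕ} {v : EuclideanSpace ℝ (Fin n)} (hv : ‖v‖ = 1) :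
    (ProbabilityTheory.stdGaussian (EuclideanSpace ℝ (Fin n))).map (fun y => inner ℝ v y) =
      gaussianReal 0 1 := by
  have h := IsGaussian.map_eq_gaussianReal
    (μ := ProbabilityTheory.stdGaussian (EuclideanSpace ℝ (Fin n))) (innerSL ℝ v)
  rw [integral_strongDual_stdGaussian, variance_dual_stdGaussian, innerSL_apply_norm, hv] at h
  simpa using h

/-- The standard Gaussian density is at most `2/5`. -/
theorem gaussianReal_Ioc_le (a b : ℝ) (hab : a ≤ b) :
    (gaussianReal 0 1).real (Set.Ioc a b) ≤ 2 / 5 * (b - a) := by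
  have hpdf : ∀ x, gaussianPDFReal 0 1 x ≤ 2 / 5 := by
    intro x
    rw [gaussianPDFReal_def]
    have h1 : (5 / 2 : ℝ) ≤ √(2 * Real.pi * ((1 : NNReal) : ℝ)) := by
      apply Real.le_sqrt_of_sq_le
      have := Real.pi_gt_d2
      push_cast
      linarith
    have h2 : (√(2 * Real.pi * ((1 : NNReal) : ℝ)))⁻¹ ≤ 2 / 5 := by
      rw [inv_le_comm₀ (by linarith) (by norm_num)]
      norm_num at h1 ⊢
      exact h1
    have h3 : Real.exp (-(x - 0) ^ 2 / (2 * ((1 : NNReal) : ℝ))) ≤ 1 := by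
      rw [Real.exp_le_one_iff]
      apply div_nonpos_of_nonpos_of_nonneg
      · nlinarith [sq_nonneg (x - 0)]
      · positivity
    exact (mul_le_mul h2 h3 (Real.exp_pos _).le (by norm_num)).trans_eq (mul_one _)
  rw [Measure.real, gaussianReal_apply_eq_integral 0 one_ne_zero,
    ENNReal.toReal_ofReal (integral_nonneg fun x => gaussianPDFReal_nonneg 0 1 x)]
  calc ∫ x in Set.Ioc a b, gaussianPDFReal 0 1 x ≤ ∫ x in Set.Ioc a b, (2 / 5 : ℝ) :=
        setIntegral_mono (integrable_gaussianPDFReal 0 1).integrableOn (by simp) hpdf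
    _ = 2 / 5 * (b - a) := by simp [hab]; ring

/-- If a standard Gaussian variable is at most `τ` on `A`, then moving mass of `A` as far up as
possible bounds its integral over `A`. -/
theorem setIntegral_le_of_map_eq_gaussianReal {Ω : Type*} [MeasurableSpace Ω] {μ : Measure Ω}
    [IsProbabilityMeasure μ] {X : Ω → ℝ} (hX : Measurable X) (hμ : μ.map X = gaussianReal 0 1)
    (hXi : Integrable X μ) {A : Set Ω} (hA : MeasurableSet A) {τ : ℝ} (hτ : ∀ y ∈ A, X y ≤ τ)
    {a : ℝ} (ha : 0 ≤ a) :
    ∫ y in A, X y ∂μ ≤ (τ - a) * μ.real A + a * (2 / 5 * a) := by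
  have hB : MeasurableSet (X ⁻¹' Set.Ioc (τ - a) τ) := hX measurableSet_Ioc
  have hBm : μ.real (X ⁻¹' Set.Ioc (τ - a) τ) ≤ 2 / 5 * a := by
    have := gaussianReal_Ioc_le (τ - a) τ (by linarith)
    rw [← hμ, map_measureReal_apply hX measurableSet_Ioc] at this
    linarith
  have hi1 : Integrable (A.indicator fun _ => τ - a) μ := (integrable_const _).indicator hA
  have hi2 : Integrable ((X ⁻¹' Set.Ioc (τ - a) τ).indicator fun _ => a) μ :=
    (integrable_const _).indicator hB
  calc ∫ y in A, X y ∂μ = ∫ y, A.indicator X y ∂μ := (integral_indicator hA).symm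
    _ ≤ ∫ y, (A.indicator (fun _ => τ - a) y +
          (X ⁻¹' Set.Ioc (τ - a) τ).indicator (fun _ => a) y) ∂μ := by
        refine integral_mono (hXi.indicator hA) (hi1.add hi2) fun y => ?_
        by_cases hy : y ∈ A
        · by_cases hy' : y ∈ X ⁻¹' Set.Ioc (τ - a) τ
          · simpa [hy, hy'] using hτ y hy
          · have : X y ≤ τ - a := by
              by_contra h
              exact hy' ⟨not_le.mp h, hτ y hy⟩
            simpa [hy, hy'] using this
        · by_cases hy' : y ∈ X ⁻¹' Set.Ioc (τ - a) τ <;> simp [hy, hy', ha]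
    _ = (τ - a) * μ.real A + a * μ.real (X ⁻¹' Set.Ioc (τ - a) τ) := by
        rw [integral_add hi1 hi2, integral_indicator_const _ hA, integral_indicator_const _ hB]
        simp [mul_comm]
    _ ≤ _ := by gcongr

theorem finite_setOf_sum_eq (n j : ℕ) : Finite {S : Fin n → ℕ // ∑ i, S i = j} := by
  refine Set.Finite.to_subtype ((Set.finite_Iic (fun _ : Fin n => j)).subset ?_)
  rintro S rfl i
  exact Finset.single_le_sum (fun _ _ => Nat.zero_le _) (Finset.mem_univ i)

theorem hermiteWeight_nonneg (n : ℕ) (f : EuclideanSpace ℝ (Fin n) → ℝ) (j : ℕ) :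
    0 ≤ hermiteWeight n f j :=
  tsum_nonneg fun _ => sq_nonneg _

theorem hermiteCoeff_single (n : ℕ) (f : EuclideanSpace ℝ (Fin n) → ℝ) (i : Fin n) :
    hermiteCoeff n f (Pi.single i 1) = ∫ x, f x * x i ∂(_root_.stdGaussian n) := by
  unfold hermiteCoeff
  congr with x
  rw [Finset.prod_eq_single i]
  · simp [normHermite]
  · intro k _ hk
    simp [normHermite, hk]
  · simp

theorem sum_sq_integral_le_hermiteWeight_one (n : ℕ) (f : EuclideanSpace ℝ (Fin n) → ℝ) :
    ∑ i, (∫ x, f x * x i ∂(_root_.stdGaussian n)) ^ 2 ≤ hermiteWeight n f 1 := by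
  have := finite_setOf_sum_eq n 1
  let e : Fin n → {S : Fin n → ℕ // ∑ i, S i = 1} := fun i => ⟨Pi.single i 1, by simp⟩
  have he : Function.Injective e := by
    intro i j hij
    by_contra h
    have := congrFun (congrArg Subtype.val hij) i
    simp [e, h] at this
  have h := tsum_comp_le_tsum_of_inj
    (f := fun S : {S : Fin n → ℕ // ∑ i, S i = 1} => (hermiteCoeff n f S.1) ^ 2)
    (Summable.of_finite) (fun _ => sq_nonneg _) he
  rw [tsum_fintype] at h
  simpa [e, hermiteCoeff_single, hermiteWeight] using h

/-- The level-one weight dominates the squared correlation with any unit linear form. -/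
theorem sq_integral_mul_inner_le_hermiteWeight_one {n : ℕ} {f : EuclideanSpace ℝ (Fin n) → ℝ}
    (hf : ∀ i, Integrable (fun x => f x * x i) (_root_.stdGaussian n))
    {v : EuclideanSpace ℝ (Fin n)} (hv : ‖v‖ = 1) :
    (∫ x, f x * inner ℝ v x ∂(_root_.stdGaussian n)) ^ 2 ≤ hermiteWeight n f 1 := by
  refine le_trans ?_ (sum_sq_integral_le_hermiteWeight_one n f)
  have h1 : ∫ x, f x * inner ℝ v x ∂(_root_.stdGaussian n) =
      ∑ i, v i * ∫ x, f x * x i ∂(_root_.stdGaussian n) := by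
    simp_rw [← integral_const_mul]
    rw [← integral_finsetSum _ fun i _ => (hf i).const_mul (v i)]
    congr with x
    simp only [PiLp.inner_apply, Finset.mul_sum]
    refine Finset.sum_congr rfl fun i _ => ?_
    simp
    ring
  have h2 : ∑ i, v i ^ 2 = 1 := by
    rw [← EuclideanSpace.real_norm_sq_eq, hv, one_pow]
  rw [h1]
  refine (Finset.sum_mul_sq_le_sq_mul_sq _ _ _).trans ?_
  rw [h2, one_mul]

theorem exists_unit_inner_le {n : ℕ} (hn : 0 < n) {U : Set (EuclideanSpace ℝ (Fin n))}
    (hU : Convex ℝ U) (hUo : IsOpen U) {x : EuclideanSpace ℝ (Fin n)} (hx : x ∉ U) :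
    ∃ v : EuclideanSpace ℝ (Fin n), ‖v‖ = 1 ∧ ∀ y ∈ U, inner ℝ v y ≤ ‖x‖ := by
  obtain ⟨f, hf⟩ := geometric_hahn_banach_open_point hU hUo hx
  set w := (InnerProductSpace.toDual ℝ (EuclideanSpace ℝ (Fin n))).symm f with hw
  have hwf : ∀ y, inner ℝ w y = f y := fun y => InnerProductSpace.toDual_symm_apply
  by_cases h0 : w = 0
  · refine ⟨EuclideanSpace.single ⟨0, hn⟩ 1, by simp, fun y hy => ?_⟩
    have := hf y hy
    rw [← hwf, ← hwf, h0] at this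
    simp at this
  · have hpos : 0 < ‖w‖ := norm_pos_iff.mpr h0
    refine ⟨‖w‖⁻¹ • w, by simp [norm_smul, hpos.ne'], fun y hy => ?_⟩
    have h1 : inner ℝ w y ≤ ‖w‖ * ‖x‖ := by
      have := hf y hy
      rw [← hwf, ← hwf] at this
      exact this.le.trans (real_inner_le_norm w x)
    rw [real_inner_smul_left, inv_mul_le_iff₀ hpos]
    exact h1

theorem pmInd_eq_indicator {n : ℕ} (K : Set (EuclideanSpace ℝ (Fin n)))
    (x : EuclideanSpace ℝ (Fin n)) : pmInd K x = 2 * K.indicator (fun _ => 1) x - 1 := by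
  by_cases h : x ∈ K <;> simp [pmInd, h]
  norm_num

/-- If `K` is convex, its Gaussian volume is within `c/n` of `1/2`, and some point of
norm at most `τ` lies outside `K`, then the Hermite weight of `K` at levels 0 and 1
is at least `1/18`. -/
theorem low_level_weight_missing_point :
    ∃ τ c : ℝ, 0 < τ ∧ τ < 1 / 10000 ∧ τ ≤ c ∧ ∃ n₀ : ℕ, ∀ n : ℕ, n₀ ≤ n →
      ∀ K : Set (EuclideanSpace ℝ (Fin n)),
        Convex ℝ K →
        |gaussVol n K - 1 / 2| ≤ c / (n : ℝ) →
        (∃ x : EuclideanSpace ℝ (Fin n), x ∉ K ∧ ‖x‖ ≤ τ) →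
        1 / 18 ≤ hermiteWeight n (pmInd K) 0 + hermiteWeight n (pmInd K) 1 := by
  refine ⟨1 / 100000, 1 / 100000, by norm_num, by norm_num, le_rfl, 1, ?_⟩
  rintro n hn K hK hvol ⟨x, hxK, hx⟩
  have hK_ae := interior_ae_eq_of_convex hK
  obtain ⟨v, hv, hvU⟩ := exists_unit_inner_le hn hK.interior isOpen_interior
    fun h => hxK (interior_subset h)
  set γ := ProbabilityTheory.stdGaussian (EuclideanSpace ℝ (Fin n)) with hγ
  have hvolU : 499 / 1000 ≤ γ.real (interior K) := by
    have h1 : γ.real (interior K) = gaussVol n K := by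
      rw [gaussVol, stdGaussian_eq, measureReal_congr hK_ae, Measure.real]
    have h2 : (1 / 100000 : ℝ) / n ≤ 1 / 100000 :=
      div_le_self (by norm_num) (by exact_mod_cast hn)
    rw [h1]
    linarith [(abs_le.mp hvol).1]
  have hint : ∀ w : EuclideanSpace ℝ (Fin n), Integrable (fun y => inner ℝ w y) γ := fun w =>
    ((innerSL ℝ w).integrable_comp IsGaussian.integrable_id)
  have hpm : ∀ᵐ y ∂γ, pmInd K y = 2 * (interior K).indicator (fun _ => 1) y - 1 := by
    filter_upwards [indicator_ae_eq_of_ae_eq_set (f := fun _ => (1 : ℝ)) hK_ae] with y hy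
    rw [hy, pmInd_eq_indicator]
  have hpmX : ∀ X : EuclideanSpace ℝ (Fin n) → ℝ, (fun y => pmInd K y * X y) =ᵐ[γ]
      fun y => 2 * (interior K).indicator X y - X y := by
    intro X
    filter_upwards [hpm] with y hy
    rw [hy]
    by_cases h : y ∈ interior K <;> simp [h]
    ring
  have hintX : ∀ X : EuclideanSpace ℝ (Fin n) → ℝ, Integrable X γ →
      Integrable (fun y => pmInd K y * X y) γ := fun X hX =>
    (((hX.indicator isOpen_interior.measurableSet).const_mul 2).sub hX).congr (hpmX X).symm
  have hcoord : ∀ i, Integrable (fun y => pmInd K y * y i) (_root_.stdGaussian n) := by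
    intro i
    rw [stdGaussian_eq]
    exact hintX _ ((EuclideanSpace.proj (𝕜 := ℝ) i).integrable_comp IsGaussian.integrable_id)
  have hW := sq_integral_mul_inner_le_hermiteWeight_one hcoord hv
  have hbound := setIntegral_le_of_map_eq_gaussianReal (μ := γ) (by fun_prop)
    (map_inner_stdGaussian hv) (hint v) isOpen_interior.measurableSet hvU
    (a := 1 / 2) (by norm_num)
  have hcorr : ∫ y, pmInd K y * inner ℝ v y ∂γ = 2 * ∫ y in interior K, inner ℝ v y ∂γ := by
    have hzero : ∫ y, inner ℝ v y ∂γ = 0 := integral_strongDual_stdGaussian (innerSL ℝ v)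
    rw [integral_congr_ae (hpmX fun y => inner ℝ v y), integral_sub _ (hint v), hzero, sub_zero,
      integral_const_mul, integral_indicator isOpen_interior.measurableSet]
    exact ((hint v).indicator isOpen_interior.measurableSet).const_mul 2
  rw [stdGaussian_eq, hcorr] at hW
  have hneg : ∫ y in interior K, inner ℝ v y ∂γ ≤ -12 / 100 := by
    have : (‖x‖ - 1 / 2) * γ.real (interior K) ≤ (-4 / 10) * (499 / 1000) := by nlinarith
    refine hbound.trans ?_
    nlinarith
  have h0 := hermiteWeight_nonneg n (pmInd K) 0
  nlinarith
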